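/- (Finite sum law of small numbers.) Let B_0,…,B_n ∈ 𝓕 be conditionally independent given 𝓖, set W := Σ_{i=0}^{n} 1_{B_i}, let H be a nonnegative version of E[W|𝓖], and let h_i be a version of ℙ[B_i|𝓖] for each i. Then for every A ⊆ ℕ: |ℙ[{W ∈ A}|𝓖] − Po(A;H)| ≤ max_{0≤i≤n} h_i almost everywhere. -/

import Mathlib

open scoped BigOperators

/-- Poisson pmf: Po(k;lam) = lam^k * e^(-lam) / k!  (with the convention 0^0 = 1). -/
noncomputable def Po (k : ℕ) (lam : ℝ) : ℝ := lam ^ k * Real.exp (-lam) / (Nat.factorial k)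

/-- Poisson measure of a set A of naturals: Po(A;lam) = sum over k in A of Po(k;lam). -/
noncomputable def PoSet (A : Set ℕ) (lam : ℝ) : ℝ := ∑' k : A, Po k lam

/-- The scalar Stein-Chen solution g(j,lam,A), defined recursively by g(0,lam,A) = 0 and
g(j,lam,A) = lam⁻¹ * ((j-1)*g(j-1,lam,A) + 1_A(j-1) - Po(A;lam))
             + (1/j) * 1_{lam=0} * (1_A(0) - 1_A(j)) for j ≥ 1,
with the convention 0⁻¹ = 0. -/
noncomputable def steinChen : ℕ → ℝ → Set ℕ → ℝ
  | 0, _, _ => 0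
  | (j + 1), lam, A =>
      lam⁻¹ * ((j : ℝ) * steinChen j lam A
          + A.indicator (fun _ => (1 : ℝ)) j - PoSet A lam)
        + (1 / ((j : ℝ) + 1)) * (if lam = 0 then (1 : ℝ) else 0)
          * (A.indicator (fun _ => (1 : ℝ)) 0 - A.indicator (fun _ => (1 : ℝ)) (j + 1))

open MeasureTheory

open ProbabilityTheory

lemma Po_nonneg (k : ℕ) {lam : ℝ} (hlam : 0 ≤ lam) : 0 ≤ Po k lam := by
  unfold Po; positivity

lemma Po_pos (k : ℕ) {lam : ℝ} (hlam : 0 < lam) : 0 < Po k lam := by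
  unfold Po; positivity

lemma hasSum_Po (lam : ℝ) : HasSum (fun k => Po k lam) 1 := by
  convert! (NormedSpace.expSeries_div_hasSum_exp lam).mul_left (Real.exp (-lam)) using 1
  · funext k
    simp only [Po]
    ring
  · simp [← Real.exp_eq_exp_ℝ, ← Real.exp_add]

lemma succ_mul_Po_succ (k : ℕ) (lam : ℝ) : ((k : ℝ) + 1) * Po (k + 1) lam = lam * Po k lam := by
  have : ((k : ℝ) + 1) ≠ 0 := by positivity
  have h2 : (k.factorial : ℝ) ≠ 0 := by positivity
  simp only [Po, Nat.factorial_succ, Nat.cast_mul, Nat.cast_succ]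
  field_simp
  ring

lemma PoSet_eq_tsum_indicator (A : Set ℕ) (lam : ℝ) :
    PoSet A lam = ∑' k, A.indicator (fun k => Po k lam) k :=
  tsum_subtype A fun k => Po k lam

lemma PoSet_zero (A : Set ℕ) : PoSet A 0 = A.indicator (fun _ => (1 : ℝ)) 0 := by
  rw [PoSet_eq_tsum_indicator, tsum_eq_single 0]
  · by_cases h : 0 ∈ A <;> simp [h, Po]
  · intro k hk
    by_cases h : k ∈ A <;> simp [h, Po, hk]

lemma mul_sum_Po_le (lam : ℝ) (hlam : 0 ≤ lam) (m : ℕ) :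
    lam * ∑ k ∈ Finset.range m, Po k lam ≤ m * ∑ k ∈ Finset.range (m + 1), Po k lam := by
  induction m with
  | zero => simp
  | succ m ih =>
    rw [Finset.sum_range_succ, Finset.sum_range_succ _ (m + 1)]
    have h1 := succ_mul_Po_succ m lam
    have h2 : 0 ≤ ∑ k ∈ Finset.range (m + 1), Po k lam :=
      Finset.sum_nonneg fun k _ => Po_nonneg k hlam
    rw [Finset.sum_range_succ] at ih h2 ⊢
    push_cast
    nlinarith

lemma mul_one_sub_sum_Po_le (lam : ℝ) (hlam : 0 ≤ lam) (m : ℕ) :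
    m * (1 - ∑ k ∈ Finset.range (m + 1), Po k lam) ≤
      lam * (1 - ∑ k ∈ Finset.range m, Po k lam) := by
  have h := fun m => (hasSum_nat_add_iff' m).2 (hasSum_Po lam)
  refine hasSum_le (fun k => ?_) ((h (m + 1)).mul_left (m : ℝ)) ((h m).mul_left lam)
  have h1 := succ_mul_Po_succ (k + m) lam
  have h2 := Po_nonneg (k + m + 1) hlam
  rw [← add_assoc, ← h1]
  push_cast
  nlinarith [(Nat.cast_nonneg k : (0 : ℝ) ≤ k)]

/-- The algebraic core of the Stein–Chen increment bound. -/
lemma abs_stein_increment_le {lam m π a b c L R : ℝ} (hlam : 0 < lam) (hm : 0 < m) (hπ : 0 < π)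
    (ha : 0 ≤ a) (haL : a ≤ L) (hb : 0 ≤ b) (hbR : b ≤ R) (hc : 0 ≤ c) (hcπ : c ≤ π)
    (hsum : L + π + R = 1) (hR : m * R ≤ lam * (π + R)) (hL : lam * L ≤ m * (L + π)) :
    |((a + c) - (a + b + c) * (L + π)) / (lam * π) - (a - (a + b + c) * L) / (m * π)| ≤
      lam⁻¹ := by
  have hN : ((a + c) - (a + b + c) * (L + π)) / (lam * π) - (a - (a + b + c) * L) / (m * π) =
      (a * (m * R - lam * (π + R)) + b * (lam * L - m * (L + π)) + c * (m * R + lam * L)) /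
        (lam * m * π) := by
    obtain rfl : R = 1 - L - π := by linarith
    field_simp
    ring
  have hinv : lam⁻¹ = (m * π) / (lam * m * π) := by field_simp
  have hR0 : 0 ≤ R := hb.trans hbR
  have hL0 : 0 ≤ L := ha.trans haL
  have h1 : 0 ≤ m * R + lam * L := by positivity
  have hm1 : m * π = m * π * (L + π + R) := by rw [hsum, mul_one]
  rw [hN, hinv, abs_div, abs_of_pos (show 0 < lam * m * π by positivity)]
  gcongr
  rw [abs_le]
  constructor
  · nlinarith [mul_le_mul_of_nonneg_right haL (sub_nonneg.2 hR),
      mul_le_mul_of_nonneg_right hbR (sub_nonneg.2 hL), mul_nonneg hc h1,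
      mul_pos (mul_pos hm hπ) hπ]
  · nlinarith [mul_nonneg ha (sub_nonneg.2 hR), mul_nonneg hb (sub_nonneg.2 hL),
      mul_le_mul_of_nonneg_right hcπ h1, mul_le_mul_of_nonneg_left hL hπ.le]

/-- The Stein–Chen equation has a solution whose increments are at most `lam⁻¹`. -/
lemma exists_stein_solution {lam : ℝ} (hlam : 0 < lam) (A : Set ℕ) :
    ∃ g : ℕ → ℝ,
      (∀ j : ℕ, lam * g (j + 1) - j * g j = A.indicator (fun _ => (1 : ℝ)) j - PoSet A lam) ∧
      ∀ j, |g (j + 2) - g (j + 1)| ≤ lam⁻¹ := by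
  set P := PoSet A lam with hP
  set f : ℕ → ℝ := A.indicator (fun k => Po k lam) with hf
  have hf0 : ∀ k, 0 ≤ f k := fun k => Set.indicator_nonneg (fun k _ => Po_nonneg k hlam.le) k
  have hfle : ∀ k, f k ≤ Po k lam := fun k =>
    Set.indicator_le_self' (fun k _ => Po_nonneg k hlam.le) k
  have hfsum : HasSum f P := by
    rw [hP, PoSet_eq_tsum_indicator]
    exact ((hasSum_Po lam).summable.indicator A).hasSum
  set g : ℕ → ℝ := fun j => (∑ k ∈ Finset.range j, f k - P * ∑ k ∈ Finset.range j, Po k lam) /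
    (j * Po j lam) with hg
  have hsucc : ∀ j : ℕ, g (j + 1) = (∑ k ∈ Finset.range j, f k + f j -
      P * (∑ k ∈ Finset.range j, Po k lam + Po j lam)) / (lam * Po j lam) := fun j => by
    simp only [hg, Nat.cast_succ, succ_mul_Po_succ, Finset.sum_range_succ]
  refine ⟨g, fun j => ?_, fun j => ?_⟩
  · have hπ := (Po_pos j hlam).ne'
    have hfj : f j = A.indicator (fun _ => (1 : ℝ)) j * Po j lam := by
      by_cases h : j ∈ A <;> simp [hf, h]
    rw [hsucc, hfj]
    rcases Nat.eq_zero_or_pos j with rfl | hj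
    · field_simp
      simp
      field_simp
    · simp only [hg]
      field_simp
      ring
  · rw [hsucc]
    have hsub := (hasSum_nat_add_iff' (j + 2)).2 hfsum
    have hsub' := (hasSum_nat_add_iff' (j + 2)).2 (hasSum_Po lam)
    have hb := hsub.nonneg fun k => hf0 _
    have hbR := hasSum_le (fun k => hfle _) hsub hsub'
    have hR := mul_one_sub_sum_Po_le lam hlam.le (j + 1)
    have hL := mul_sum_Po_le lam hlam.le (j + 1)
    rw [Finset.sum_range_succ] at hb
    rw [Finset.sum_range_succ, Finset.sum_range_succ _ (j + 1)] at hbR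
    rw [Finset.sum_range_succ _ (j + 1)] at hR hL
    have key := abs_stein_increment_le (m := ((j + 1 : ℕ) : ℝ)) hlam (by positivity)
      (Po_pos (j + 1) hlam)
      (Finset.sum_nonneg fun k (_ : k ∈ Finset.range (j + 1)) => hf0 k)
      (Finset.sum_le_sum fun k (_ : k ∈ Finset.range (j + 1)) => hfle k)
      hb hbR (hf0 (j + 1)) (hfle (j + 1)) (by ring) (by linarith) (by linarith)
    convert key using 3
    · congr 1
      ring
    · simp only [hg]
      congr 1
      ring

section Independent

variable {Ω ι : Type*} [MeasurableSpace Ω] {ν : Measure Ω} [IsProbabilityMeasure ν]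

lemma integrable_comp_of_le {W : Ω → ℕ} (hW : Measurable W) {N : ℕ} (hN : ∀ ω, W ω ≤ N)
    (u : ℕ → ℝ) : Integrable (fun ω => u (W ω)) ν := by
  refine Integrable.of_bound
    ((measurable_of_countable u).comp hW).aestronglyMeasurable
    (∑ k ∈ Finset.range (N + 1), |u k|) (.of_forall fun ω => ?_)
  exact Finset.single_le_sum (f := fun k => |u k|) (fun _ _ => abs_nonneg _)
    (Finset.mem_range.2 (Nat.lt_succ_of_le (hN ω)))

open Classical in
lemma integral_ite_of_indepFun_indicator {b : Set Ω} (hb : MeasurableSet b) {V : Ω → ℕ}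
    (hV : Measurable V) {N : ℕ} (hN : ∀ ω, V ω ≤ N)
    (hind : IndepFun (b.indicator fun _ => (1 : ℕ)) V ν) (u v : ℕ → ℝ) :
    ∫ ω, (if ω ∈ b then u (V ω) else v (V ω)) ∂ν =
      ν.real b * ∫ ω, u (V ω) ∂ν + (1 - ν.real b) * ∫ ω, v (V ω) ∂ν := by
  have hX : Measurable (b.indicator fun _ => (1 : ℕ)) := measurable_const.indicator hb
  have hmul : ∀ φ w : ℕ → ℝ,
      ∫ ω, φ (b.indicator (fun _ => (1 : ℕ)) ω) * w (V ω) ∂ν =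
        (∫ ω, φ (b.indicator (fun _ => (1 : ℕ)) ω) ∂ν) * ∫ ω, w (V ω) ∂ν := fun φ w =>
    hind.integral_fun_comp_mul_comp hX.aemeasurable hV.aemeasurable
      (measurable_of_countable φ).aestronglyMeasurable
      (measurable_of_countable w).aestronglyMeasurable
  have hintegrable : ∀ φ w : ℕ → ℝ,
      Integrable (fun ω => φ (b.indicator (fun _ => (1 : ℕ)) ω) * w (V ω)) ν := fun φ w =>
    (hind.comp (measurable_of_countable φ) (measurable_of_countable w)).integrable_mul
      (integrable_comp_of_le hX (N := 1) (fun ω => Set.indicator_le_self' (by simp) ω) φ)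
      (integrable_comp_of_le hV hN w)
  have h1 : ∫ ω, ((b.indicator (fun _ => (1 : ℕ)) ω : ℕ) : ℝ) ∂ν = ν.real b := by
    rw [← integral_indicator_one hb]
    congr with ω
    by_cases h : ω ∈ b <;> simp [h]
  have h2 : ∫ ω, (1 - ((b.indicator (fun _ => (1 : ℕ)) ω : ℕ) : ℝ)) ∂ν = 1 - ν.real b := by
    rw [integral_sub (integrable_const _)
      (integrable_comp_of_le hX (N := 1) (fun ω => Set.indicator_le_self' (by simp) ω)
        fun k => (k : ℝ)), h1]
    simp
  rw [← h2, ← h1, ← hmul (fun k => (k : ℝ)) u, ← hmul (fun k => 1 - (k : ℝ)) v,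
    ← integral_add (hintegrable (fun k => (k : ℝ)) u) (hintegrable (fun k => 1 - (k : ℝ)) v)]
  congr with ω
  by_cases h : ω ∈ b <;> simp [h]

variable [Fintype ι] {B : ι → Set Ω}

/-- Size-bias identity for a sum of independent indicators. -/
lemma exists_integral_sub_eq_sq_mul (hB : ∀ i, MeasurableSet (B i)) (hind : iIndepSet B ν)
    (g : ℕ → ℝ) (i : ι) :
    ∃ V : Ω → ℕ, Measurable V ∧ (∀ ω, V ω ≤ Fintype.card ι) ∧
      ν.real (B i) * ∫ ω, g (∑ j, (B j).indicator (fun _ => (1 : ℕ)) ω + 1) ∂ν -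
        ∫ ω, (((B i).indicator (fun _ => (1 : ℕ)) ω : ℕ) : ℝ) *
          g (∑ j, (B j).indicator (fun _ => (1 : ℕ)) ω) ∂ν =
      ν.real (B i) ^ 2 * ∫ ω, (g (V ω + 2) - g (V ω + 1)) ∂ν := by
  classical
  set X : ι → Ω → ℕ := fun j => (B j).indicator fun _ => (1 : ℕ) with hX
  have hXm : ∀ j, Measurable (X j) := fun j => measurable_const.indicator (hB j)
  set V : Ω → ℕ := ∑ j ∈ Finset.univ.erase i, X j with hV
  have hVm : Measurable V := by
    rw [hV, Finset.sum_fn]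
    exact Finset.measurable_sum _ fun j _ => hXm j
  have hVle : ∀ ω, V ω ≤ Fintype.card ι := fun ω => by
    rw [hV, Finset.sum_apply]
    calc ∑ j ∈ Finset.univ.erase i, X j ω ≤ ∑ j ∈ Finset.univ.erase i, 1 :=
          Finset.sum_le_sum fun j _ => Set.indicator_le_self' (by simp) ω
      _ ≤ Fintype.card ι := by simp
  have hVi : IndepFun (X i) V ν :=
    (hind.iIndepFun_indicator.indepFun_finsetSum_of_notMem hXm
      (Finset.notMem_erase i Finset.univ)).symm
  have hsum : ∀ ω, ∑ j, X j ω = X i ω + V ω := fun ω => by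
    rw [hV, Finset.sum_apply, Finset.add_sum_erase _ (fun j => X j ω) (Finset.mem_univ i)]
  refine ⟨V, hVm, hVle, ?_⟩
  have e1 := integral_ite_of_indepFun_indicator (hB i) hVm hVle hVi
    (fun k => g (k + 2)) (fun k => g (k + 1))
  have e2 := integral_ite_of_indepFun_indicator (hB i) hVm hVle hVi
    (fun k => g (k + 1)) (fun _ => 0)
  have f1 : ∀ ω, g (∑ j, X j ω + 1) = if ω ∈ B i then g (V ω + 2) else g (V ω + 1) := fun ω => by
    rw [hsum]
    by_cases h : ω ∈ B i
    · simp only [hX, h, Set.indicator_of_mem, if_true]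
      congr 1
      ring
    · simp [hX, h]
  have f2 : ∀ ω, (X i ω : ℝ) * g (∑ j, X j ω) = if ω ∈ B i then g (V ω + 1) else 0 := fun ω => by
    rw [hsum]
    by_cases h : ω ∈ B i <;> simp [hX, h, add_comm]
  change ν.real (B i) * ∫ ω, g (∑ j, X j ω + 1) ∂ν - ∫ ω, (X i ω : ℝ) * g (∑ j, X j ω) ∂ν = _
  simp only [f1, f2]
  rw [e1, e2, integral_sub (integrable_comp_of_le hVm hVle fun k => g (k + 2))
    (integrable_comp_of_le hVm hVle fun k => g (k + 1))]
  simp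
  ring

/-- Poisson approximation of a sum of independent indicators, by the Stein–Chen method. -/
theorem abs_measureReal_sub_PoSet_le (hB : ∀ i, MeasurableSet (B i)) (hind : iIndepSet B ν)
    (A : Set ℕ) {M : ℝ} (hM0 : 0 ≤ M) (hM : ∀ i, ν.real (B i) ≤ M) :
    |ν.real {ω | ∑ i, (B i).indicator (fun _ => (1 : ℕ)) ω ∈ A} - PoSet A (∑ i, ν.real (B i))| ≤
      M := by
  set W : Ω → ℕ := fun ω => ∑ i, (B i).indicator (fun _ => (1 : ℕ)) ω with hW
  have hXm : ∀ j, Measurable ((B j).indicator fun _ => (1 : ℕ)) :=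
    fun j => measurable_const.indicator (hB j)
  have hWm : Measurable W := Finset.measurable_fun_sum _ fun j _ => hXm j
  have hWle : ∀ ω, W ω ≤ Fintype.card ι := fun ω =>
    calc W ω ≤ ∑ _j : ι, 1 := Finset.sum_le_sum fun j _ => Set.indicator_le_self' (by simp) ω
      _ = Fintype.card ι := by simp
  set lam := ∑ i, ν.real (B i) with hlam
  have hA : ν.real {ω | W ω ∈ A} = ∫ ω, A.indicator (fun _ => (1 : ℝ)) (W ω) ∂ν := by
    exact (integral_indicator_one (hWm (MeasurableSet.of_discrete (s := A)))).symm
  change |ν.real {ω | W ω ∈ A} - PoSet A lam| ≤ M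
  have hlam0 : 0 ≤ lam := Finset.sum_nonneg fun _ _ => measureReal_nonneg
  rcases hlam0.eq_or_lt with h0 | hpos
  · have hW0 : ∀ᵐ ω ∂ν, W ω = 0 := by
      have hi : ∀ i, ∀ᵐ ω ∂ν, ω ∉ B i := fun i => by
        have := (Finset.sum_eq_zero_iff_of_nonneg fun i _ => measureReal_nonneg).1 h0.symm i
          (Finset.mem_univ i)
        exact measure_eq_zero_iff_ae_notMem.1 ((measureReal_eq_zero_iff).1 this)
      filter_upwards [ae_all_iff.2 hi] with ω hω
      simp [hW, hω]
    have : ∫ ω, A.indicator (fun _ => (1 : ℝ)) (W ω) ∂ν = A.indicator (fun _ => (1 : ℝ)) 0 := by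
      rw [integral_congr_ae (g := fun _ => A.indicator (fun _ => (1 : ℝ)) 0)
        (hW0.mono fun ω hω => by simp only [hω])]
      simp
    rwa [hA, this, ← h0, PoSet_zero, sub_self, abs_zero]
  · obtain ⟨g, hg, hΔ⟩ := exists_stein_solution hpos A
    have hXint : ∀ i, Integrable
        (fun ω => (((B i).indicator (fun _ => (1 : ℕ)) ω : ℕ) : ℝ) * g (W ω)) ν := fun i => by
      refine ((integrable_comp_of_le hWm hWle g).indicator (hB i)).congr (.of_forall fun ω => ?_)
      by_cases h : ω ∈ B i <;> simp [h]
    have hstein : ν.real {ω | W ω ∈ A} - PoSet A lam =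
        ∑ i, (ν.real (B i) * ∫ ω, g (W ω + 1) ∂ν -
          ∫ ω, (((B i).indicator (fun _ => (1 : ℕ)) ω : ℕ) : ℝ) * g (W ω) ∂ν) := by
      rw [Finset.sum_sub_distrib, ← Finset.sum_mul, ← integral_finsetSum _ fun i _ => hXint i,
        ← hlam, ← integral_const_mul, ← integral_sub
          ((integrable_comp_of_le hWm hWle fun k => g (k + 1)).const_mul lam)
          (integrable_finsetSum _ fun i _ => hXint i), hA]
      have : PoSet A lam = ∫ _ω, PoSet A lam ∂ν := by simp
      rw [this, ← integral_sub (integrable_comp_of_le hWm hWle _) (integrable_const _)]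
      congr with ω
      rw [← hg, ← Finset.sum_mul, hW]
      push_cast
      rfl
    have hterm : ∀ i, |ν.real (B i) * ∫ ω, g (W ω + 1) ∂ν -
          ∫ ω, (((B i).indicator (fun _ => (1 : ℕ)) ω : ℕ) : ℝ) * g (W ω) ∂ν| ≤
        M * lam⁻¹ * ν.real (B i) := fun i => by
      obtain ⟨V, -, -, hV⟩ := exists_integral_sub_eq_sq_mul hB hind g i
      rw [hV, abs_mul, abs_of_nonneg (sq_nonneg _)]
      have hI : |∫ ω, (g (V ω + 2) - g (V ω + 1)) ∂ν| ≤ lam⁻¹ := by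
        simpa using norm_integral_le_of_norm_le_const (μ := ν)
          (f := fun ω => g (V ω + 2) - g (V ω + 1)) (.of_forall fun ω => hΔ (V ω))
      calc ν.real (B i) ^ 2 * |∫ ω, (g (V ω + 2) - g (V ω + 1)) ∂ν|
          ≤ ν.real (B i) * M * lam⁻¹ := by
            rw [pow_two]
            gcongr
            exact hM i
        _ = M * lam⁻¹ * ν.real (B i) := by ring
    rw [hstein]
    calc _ ≤ ∑ i, M * lam⁻¹ * ν.real (B i) :=
          (Finset.abs_sum_le_sum_abs _ _).trans (Finset.sum_le_sum fun i _ => hterm i)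
      _ = M := by
          rw [← Finset.mul_sum, ← hlam, mul_assoc, inv_mul_cancel₀ hpos.ne', mul_one]

end Independent

/-- Finite sum law of small numbers (Theorem 4.11, scalar instance): for events
B_0,...,B_n conditionally independent given 𝓖, W = Σ_i 1_{B_i}, H a nonnegative version
of E[W|𝓖] and h_i a version of P[B_i|𝓖], for every A ⊆ ℕ,
|P[{W ∈ A}|𝓖] - Po(A;H)| ≤ max_i h_i almost everywhere. -/
theorem lawOfSmallNumbers_finite
    {Ω : Type*} (𝓖 : MeasurableSpace Ω) [mΩ : MeasurableSpace Ω] [StandardBorelSpace Ω]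
    (h𝓖 : 𝓖 ≤ mΩ)
    (μ : Measure Ω) [IsProbabilityMeasure μ]
    (n : ℕ) (B : Fin (n + 1) → Set Ω) (hBmeas : ∀ i, MeasurableSet (B i))
    (hBindep : ProbabilityTheory.iCondIndepSet 𝓖 h𝓖 B μ)
    (W : Ω → ℕ) (hW : W = fun ω => ∑ i, (B i).indicator (fun _ => (1 : ℕ)) ω)
    (H : Ω → ℝ) (hH0 : ∀ ω, 0 ≤ H ω)
    (hH : H =ᵐ[μ] μ[fun ω => (W ω : ℝ) | 𝓖])
    (h : Fin (n + 1) → Ω → ℝ)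
    (hh : ∀ i, h i =ᵐ[μ] μ[(B i).indicator (fun _ => (1 : ℝ)) | 𝓖])
    (A : Set ℕ) :
    ∀ᵐ ω ∂μ,
      |(μ[Set.indicator {ω' | W ω' ∈ A} (fun _ => (1 : ℝ)) | 𝓖]) ω - PoSet A (H ω)|
        ≤ ⨆ i, h i ω := by
  have hWm : Measurable W := by
    rw [hW]
    exact Finset.measurable_fun_sum _ fun j _ => measurable_const.indicator (hBmeas j)
  have hreal : ∀ {s : Set Ω}, MeasurableSet s →
      μ[s.indicator (fun _ => (1 : ℝ)) | 𝓖] =ᵐ[μ] fun ω => (condExpKernel μ 𝓖 ω).real s :=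
    fun hs => (condExpKernel_ae_eq_condExp h𝓖 hs).symm
  have hBint : ∀ i, Integrable ((B i).indicator (fun _ => (1 : ℝ))) μ :=
    fun i => (integrable_const 1).indicator (hBmeas i)
  have hWeq : (fun ω => (W ω : ℝ)) = ∑ i, (B i).indicator (fun _ => (1 : ℝ)) := by
    funext ω
    rw [hW, Finset.sum_apply]
    push_cast
    exact Finset.sum_congr rfl fun i _ => by by_cases h : ω ∈ B i <;> simp [h]
  have hcondW : μ[fun ω => (W ω : ℝ) | 𝓖] =ᵐ[μ]
      ∑ i, μ[(B i).indicator (fun _ => (1 : ℝ)) | 𝓖] := by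
    rw [hWeq]
    exact condExp_finsetSum (fun i _ => hBint i) 𝓖
  have hind : ∀ᵐ ω ∂μ, iIndepSet B (condExpKernel μ 𝓖 ω) := by
    have hall := fun S => ae_of_ae_trim h𝓖
      ((Kernel.iIndepSet_iff_meas_biInter hBmeas).1 hBindep S)
    filter_upwards [ae_all_iff.2 hall] with ω hω
    exact (iIndepSet_iff_meas_biInter hBmeas).2 hω
  filter_upwards [hH, hcondW, ae_all_iff.2 hh, ae_all_iff.2 fun i => hreal (hBmeas i),
    hreal (hWm (MeasurableSet.of_discrete (s := A))), hind] with ω hHω hWω hhω hBω hAω hindω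
  have hp : ∀ i, (condExpKernel μ 𝓖 ω).real (B i) = h i ω := fun i => by rw [hhω, hBω]
  have hle : ∀ i, (condExpKernel μ 𝓖 ω).real (B i) ≤ ⨆ i, h i ω := fun i =>
    (hp i).trans_le (le_ciSup (Set.finite_range fun i => h i ω).bddAbove i)
  have hHsum : H ω = ∑ i, (condExpKernel μ 𝓖 ω).real (B i) := by
    rw [hHω, hWω, Finset.sum_apply]
    exact Finset.sum_congr rfl fun i _ => hBω i
  have hmain := abs_measureReal_sub_PoSet_le hBmeas hindω A (measureReal_nonneg.trans (hle 0)) hle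
  change (μ[Set.indicator {ω' | W ω' ∈ A} (fun _ => (1 : ℝ)) | 𝓖]) ω = _ at hAω
  rw [hAω, hHsum]
  subst hW
  exact hmain
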